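/- arXiv:1601.07984 — 2 statements merged into one kernel-verified Lean document; each statement's English description precedes it below -/
import Mathlib

section
/- Let X and Y be compact Hausdorff spaces, E ⊆ X × Y a closed, horizontally and vertically one-pointed set, and g : E → ℝ a function of the first Baire class. Then there exists a separately continuous function f : X × Y → ℝ with f|_E = g. -/
open Set Filter Topology

/-- Piecewise linear interpolation, partial version. -/
noncomputable def interpP (z : ℕ → ℝ) (M : ℕ) (s : ℝ) : ℝ :=
  z 0 + ∑ n ∈ Finset.range M, max 0 (min 1 (s - n)) * (z (n + 1) - z n)

lemma interpP_eq (z : ℕ → ℝ) (M : ℕ) (s : ℝ) (h : (M : ℝ) ≤ s) : interpP z M s = z M := by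
  induction M with
  | zero => simp [interpP]
  | succ k ih =>
    push_cast at h
    have := ih (by linarith)
    unfold interpP at this ⊢
    rw [Finset.sum_range_succ, ← add_assoc, this, min_eq_left (by linarith), max_eq_right (by norm_num)]
    ring

lemma interpP_stab (z : ℕ → ℝ) (M K : ℕ) (s : ℝ) (h : s ≤ M) (hK : M ≤ K) :
    interpP z K s = interpP z M s := by
  induction K, hK using Nat.le_induction with
  | base => rfl
  | succ k hk ih =>
    rw [← ih]
    unfold interpP
    have : (M : ℝ) ≤ k := by exact_mod_cast hk
    rw [Finset.sum_range_succ, max_eq_left (le_trans (min_le_right _ _) (by linarith))]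
    ring

noncomputable def interpG (z : ℕ → ℝ) (s : ℝ) : ℝ := interpP z (⌊s⌋₊ + 1) s

lemma interpG_eq (z : ℕ → ℝ) (s : ℝ) (M : ℕ) (h : s < M) : interpG z s = interpP z M s := by
  unfold interpG
  rcases le_total (⌊s⌋₊ + 1) M with h1 | h1
  · rw [interpP_stab z _ M s _ h1]
    push_cast
    exact (Nat.lt_floor_add_one s).le
  · exact interpP_stab z _ _ s h.le h1

lemma interpG_near (z : ℕ → ℝ) (s L ε : ℝ) (hs : 0 ≤ s) (h0 : |z ⌊s⌋₊ - L| ≤ ε)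
    (h1 : |z (⌊s⌋₊ + 1) - L| ≤ ε) : |interpG z s - L| ≤ ε := by
  have e := interpP_eq z ⌊s⌋₊ s (Nat.floor_le hs)
  unfold interpG interpP at *
  rw [Finset.sum_range_succ, ← add_assoc, e]
  set c := max 0 (min 1 (s - (⌊s⌋₊ : ℝ))) with hc
  have c0 : 0 ≤ c := le_max_left _ _
  have c1 : c ≤ 1 := max_le (by norm_num) (min_le_left _ _)
  rw [abs_le] at *
  constructor <;> nlinarith

lemma core {X Y : Type*} [TopologicalSpace X] [TopologicalSpace Y]
    (u : ℕ → X → ℝ) (v : ℕ → Y → ℝ) (hu : ∀ n, Continuous (u n))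
    (d : X × Y → ℝ) (hd : Continuous d) (hd0 : ∀ p, 0 ≤ d p)
    (hm : ∀ p (n : ℕ), min (Real.exp (-(n : ℝ))) |u n p.1 - v n p.2| ≤ d p)
    (hL : ∀ p, d p = 0 → ∃ L, Tendsto (fun n => u n p.1) atTop (𝓝 L)) :
    ∃ f : X × Y → ℝ,
      (∀ x : X, Continuous fun y => f (x, y)) ∧
      (∀ y : Y, Continuous fun x => f (x, y)) ∧
      (∀ p, d p = 0 → Tendsto (fun n => u n p.1) atTop (𝓝 (f p))) := by
  classical
  have hm' : ∀ p (n : ℕ), d p < Real.exp (-(n : ℝ)) → |u n p.1 - v n p.2| ≤ d p := by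
    intro p n h
    rcases min_le_iff.1 (hm p n) with h1 | h1
    · linarith
    · exact h1
  choose! l hl using hL
  let f : X × Y → ℝ := fun p =>
    if d p = 0 then l p else interpG (fun n => u n p.1) (-Real.log (d p) - 2)
  have f0 : ∀ p, d p = 0 → f p = l p := fun p h => if_pos h
  have f1 : ∀ p, d p ≠ 0 → f p = interpG (fun n => u n p.1) (-Real.log (d p) - 2) :=
    fun p h => if_neg h
  have near : ∀ p (N : ℕ) (L ε : ℝ), d p < Real.exp (-(N : ℝ) - 2) →
      (∀ n : ℕ, N ≤ n → d p < Real.exp (-(n : ℝ)) → |u n p.1 - L| ≤ ε) → |f p - L| ≤ ε := by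
    intro p N L ε hN H
    by_cases h : d p = 0
    · rw [f0 p h]
      have t := ((hl p h).sub_const L).abs
      refine le_of_tendsto t ?_
      filter_upwards [eventually_ge_atTop N] with n hn
      exact H n hn (by rw [h]; exact Real.exp_pos _)
    · have hp : 0 < d p := lt_of_le_of_ne (hd0 p) (Ne.symm h)
      have hlog := (Real.log_lt_iff_lt_exp hp).2 hN
      rw [f1 p h]
      have hs : (N : ℝ) ≤ -Real.log (d p) - 2 := by linarith
      have hs0 : 0 ≤ -Real.log (d p) - 2 := le_trans (Nat.cast_nonneg N) hs
      have hfl := Nat.floor_le hs0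
      have hNf := Nat.le_floor hs
      apply interpG_near _ _ _ _ hs0
      · exact H _ hNf ((Real.log_lt_iff_lt_exp hp).1 (by linarith))
      · exact H _ (by omega) ((Real.log_lt_iff_lt_exp hp).1 (by push_cast; linarith))
  have cpos : ∀ p, d p ≠ 0 → ContinuousAt f p := by
    intro p h
    obtain ⟨M, hM⟩ := exists_nat_gt (-Real.log (d p) - 2)
    have cs : ContinuousAt (fun q => -Real.log (d q) - 2) p :=
      ((hd.continuousAt.log h).neg).sub_const 2
    have c1 : ContinuousAt
        (fun q : X × Y => interpP (fun n => u n q.1) M (-Real.log (d q) - 2)) p := by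
      unfold interpP
      have hu' : ∀ n, ContinuousAt (fun q : X × Y => u n q.1) p :=
        fun n => ((hu n).comp continuous_fst).continuousAt
      refine (hu' 0).add ?_
      refine tendsto_finsetSum _ fun n _ => ?_
      have c2 : ContinuousAt
          (fun q => max 0 (min 1 ((-Real.log (d q) - 2) - (n : ℝ)))) p :=
        continuousAt_const.max (continuousAt_const.min (cs.sub_const _))
      exact c2.mul ((hu' (n + 1)).sub (hu' n))
    refine c1.congr ?_
    filter_upwards [cs.eventually_lt_const hM, hd.continuousAt.eventually_ne h] with q hq hq0
    rw [f1 q hq0, interpG_eq _ _ M hq]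
  have key : ∀ p, d p = 0 → ∀ n, u n p.1 = v n p.2 := by
    intro p h n
    have := hm' p n (by rw [h]; exact Real.exp_pos _)
    rw [h] at this
    have := abs_nonpos_iff.1 this
    linarith
  refine ⟨f, ?_, ?_, ?_⟩
  · intro x
    rw [continuous_iff_continuousAt]
    intro y
    by_cases h : d (x, y) = 0
    · rw [Metric.continuousAt_iff']
      intro ε hε
      obtain ⟨N, hN⟩ := Metric.tendsto_atTop.1 (hl _ h) (ε / 2) (by linarith)
      have cd : ContinuousAt (fun y' => d (x, y')) y := by fun_prop
      have e1 := cd.eventually_lt_const (u := Real.exp (-(N : ℝ) - 2))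
        (by beta_reduce; rw [h]; exact Real.exp_pos _)
      filter_upwards [e1] with y' hy'
      have := near (x, y') N (l (x, y)) (ε / 2) hy' (fun n hn _ => (hN n hn).le)
      rw [f0 _ h, Real.dist_eq]
      linarith
    · exact ContinuousAt.comp (f := fun y' => (x, y')) (cpos _ h) (by fun_prop)
  · intro y
    rw [continuous_iff_continuousAt]
    intro x
    by_cases h : d (x, y) = 0
    · rw [Metric.continuousAt_iff']
      intro ε hε
      obtain ⟨N, hN⟩ := Metric.tendsto_atTop.1 (hl _ h) (ε / 2) (by linarith)
      have cd : ContinuousAt (fun x' => d (x', y)) x := by fun_prop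
      have e1 := cd.eventually_lt_const (u := Real.exp (-(N : ℝ) - 2))
        (by beta_reduce; rw [h]; exact Real.exp_pos _)
      have e2 := cd.eventually_lt_const (u := ε / 4) (by beta_reduce; rw [h]; linarith)
      filter_upwards [e1, e2] with x' hx' hx2
      have := near (x', y) N (l (x, y)) (ε / 2 + ε / 4) hx' (fun n hn hlt => by
        have a1 := hm' (x', y) n hlt
        have a2 := hN n hn
        have a3 := key _ h n
        rw [Real.dist_eq] at a2
        simp only at a1 a2 a3 ⊢
        rw [a3] at a2
        have := abs_sub_le (u n x') (v n y) (l (x, y))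
        linarith)
      rw [f0 _ h, Real.dist_eq]
      linarith
    · exact ContinuousAt.comp (f := fun x' => (x', y)) (cpos _ h) (by fun_prop)
  · intro p h
    rw [f0 p h]
    exact hl p h

theorem stmt12 {X Y : Type*} [TopologicalSpace X] [TopologicalSpace Y]
    [CompactSpace X] [T2Space X] [CompactSpace Y] [T2Space Y]
    (E : Set (X × Y)) (hEclosed : IsClosed E)
    (hv : ∀ x : X, {y : Y | (x, y) ∈ E}.Subsingleton)
    (hh : ∀ y : Y, {x : X | (x, y) ∈ E}.Subsingleton)
    (g : E → ℝ)
    (hg : ∃ gs : ℕ → E → ℝ, (∀ n, Continuous (gs n)) ∧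
      ∀ p : E, Tendsto (fun n => gs n p) atTop (𝓝 (g p))) :
    ∃ f : X × Y → ℝ,
      (∀ x : X, Continuous fun y => f (x, y)) ∧
      (∀ y : Y, Continuous fun x => f (x, y)) ∧
      (∀ p : E, f p = g p) := by
  obtain ⟨gs, gc, gl⟩ := hg
  rcases isEmpty_or_nonempty E with hE | hE
  · exact ⟨fun _ => 0, fun _ => continuous_const, fun _ => continuous_const, fun p => hE.elim p⟩
  haveI : CompactSpace E := isCompact_iff_compactSpace.1 hEclosed.isCompact
  have ce1 : Continuous (fun p : E => p.1.1) := by fun_prop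
  have ce2 : Continuous (fun p : E => p.1.2) := by fun_prop
  have i1 : Function.Injective (fun p : E => p.1.1) := by
    rintro ⟨⟨a, b⟩, h⟩ ⟨⟨a', b'⟩, h'⟩ e
    simp only at e
    subst e
    have := hv a h h'
    subst this
    rfl
  have i2 : Function.Injective (fun p : E => p.1.2) := by
    rintro ⟨⟨a, b⟩, h⟩ ⟨⟨a', b'⟩, h'⟩ e
    simp only at e
    subst e
    have := hh b h h'
    subst this
    rfl
  have H1 := fun n => ContinuousMap.exists_extension (ce1.isClosedEmbedding i1) ⟨gs n, gc n⟩
  have H2 := fun n => ContinuousMap.exists_extension (ce2.isClosedEmbedding i2) ⟨gs n, gc n⟩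
  choose u hu using H1
  choose v hv' using H2
  have hu1 : ∀ n (p : E), u n p.1.1 = gs n p := fun n p => DFunLike.congr_fun (hu n) p
  have hv1 : ∀ n (p : E), v n p.1.2 = gs n p := fun n p => DFunLike.congr_fun (hv' n) p
  let K : Set (ℕ → ℝ) := range (fun (p : E) n => gs n p)
  have hK : IsCompact K := isCompact_range (continuous_pi gc)
  have hKc := hK.isClosed
  have hKn : K.Nonempty := range_nonempty _
  obtain ⟨k, kc, k0, kK⟩ : ∃ k : (ℕ → ℝ) → ℝ, Continuous k ∧ (∀ z, 0 ≤ k z) ∧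
      ∀ z, z ∈ K ↔ k z = 0 := by
    letI := TopologicalSpace.metrizableSpaceMetric (ℕ → ℝ)
    exact ⟨fun z => Metric.infDist z K, Metric.continuous_infDist_pt K,
      fun z => Metric.infDist_nonneg, fun z => hKc.mem_iff_infDist_zero hKn⟩
  let a : ℕ → X × Y → ℝ := fun n p => min (Real.exp (-(n : ℝ))) |u n p.1 - v n p.2|
  have a0 : ∀ n p, 0 ≤ a n p := fun n p => le_min (Real.exp_pos _).le (abs_nonneg _)
  have ab : ∀ n p, ‖a n p‖ ≤ Real.exp (-(n : ℝ)) := fun n p => by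
    rw [Real.norm_of_nonneg (a0 n p)]; exact min_le_left _ _
  have hsum : Summable (fun n : ℕ => Real.exp (-(n : ℝ))) := Real.summable_exp_neg_nat
  have as : ∀ p, Summable (fun n => a n p) := fun p => Summable.of_norm_bounded hsum (fun n => ab n p)
  have ac : Continuous (fun p => ∑' n, a n p) :=
    continuous_tsum (fun n => by fun_prop) hsum ab
  have t0 : ∀ p, 0 ≤ ∑' n, a n p := fun p => tsum_nonneg (fun n => a0 n p)
  obtain ⟨f, fx, fy, fl⟩ := core (fun n => u n) (fun n => v n) (fun n => (u n).continuous)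
    (fun p => ∑' n, a n p + k (fun n => u n p.1))
    (ac.add (kc.comp (continuous_pi fun n => by fun_prop)))
    (fun p => add_nonneg (t0 p) (k0 _))
    (fun p n => le_add_of_le_of_nonneg ((as p).le_tsum n (fun j _ => a0 j p)) (k0 _))
    (by
      intro p h
      have h1 := t0 p
      have h2 := k0 (fun n => u n p.1)
      have h3 : k (fun n => u n p.1) = 0 := by linarith
      obtain ⟨q, hq⟩ := (kK _).2 h3
      refine ⟨g q, (gl q).congr fun n => ?_⟩
      exact congrFun hq n)
  refine ⟨f, fx, fy, fun p => ?_⟩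
  have hp := fl p.1 (by
    have e1 : ∀ n, a n p.1 = 0 := fun n => by
      simp only [a, hu1, hv1, sub_self, abs_zero]
      exact min_eq_right (Real.exp_pos _).le
    have e2 : k (fun n => u n p.1.1) = 0 :=
      (kK _).1 ⟨p, funext fun n => (hu1 n p).symm⟩
    simp only [e1, e2, tsum_zero, add_zero])
  exact tendsto_nhds_unique hp ((gl p).congr fun n => (hu1 n p).symm)
end

section
/- Let X and Y be locally compact Hausdorff spaces such that X × Y is paracompact, E ⊆ X × Y a closed, horizontally and vertically one-pointed set, and g : E → ℝ a function of the first Baire class. Then there exists a separately continuous function f : X × Y → ℝ with f|_E = g. -/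
open Set Filter Topology

noncomputable def interp (s : ℕ → ℝ) (τ : ℝ) : ℝ :=
  s 0 + ∑ n ∈ Finset.range (⌊τ⌋₊ + 1), max 0 (min 1 (τ - n)) * (s (n + 1) - s n)

lemma interp_eq_sum (s : ℕ → ℝ) (τ : ℝ) (N : ℕ) (hN : ⌊τ⌋₊ + 1 ≤ N) :
    interp s τ = s 0 + ∑ n ∈ Finset.range N, max 0 (min 1 (τ - n)) * (s (n + 1) - s n) := by
  unfold interp
  congr 1
  apply Finset.sum_subset
  · intro n hn
    simp only [Finset.mem_range] at *
    omega
  · intro n hn hn'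
    simp only [Finset.mem_range] at *
    have : τ < n := Nat.lt_of_floor_lt (by omega)
    have h : max 0 (min 1 (τ - n)) = 0 := by
      apply max_eq_left
      exact (min_le_right _ _).trans (by linarith)
    rw [h, zero_mul]

lemma interp_eq_convex (s : ℕ → ℝ) (τ : ℝ) (hτ : 0 ≤ τ) :
    interp s τ = (1 - (τ - ⌊τ⌋₊)) * s ⌊τ⌋₊ + (τ - ⌊τ⌋₊) * s (⌊τ⌋₊ + 1) := by
  unfold interp
  have h0 : (⌊τ⌋₊ : ℝ) ≤ τ := Nat.floor_le hτ
  have h1 : τ < ⌊τ⌋₊ + 1 := Nat.lt_floor_add_one τ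
  rw [Finset.sum_range_succ]
  have h2 : ∑ n ∈ Finset.range ⌊τ⌋₊, max 0 (min 1 (τ - n)) * (s (n + 1) - s n)
      = ∑ n ∈ Finset.range ⌊τ⌋₊, (s (n + 1) - s n) := by
    apply Finset.sum_congr rfl
    intro n hn
    have : n + 1 ≤ ⌊τ⌋₊ := Finset.mem_range.1 hn
    have : (n : ℝ) + 1 ≤ ⌊τ⌋₊ := by exact_mod_cast this
    rw [min_eq_left (by linarith), max_eq_right (by norm_num), one_mul]
  rw [h2, Finset.sum_range_sub, min_eq_right (by linarith), max_eq_right (by linarith)]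
  ring

lemma interp_sub_le (s : ℕ → ℝ) (τ L ε : ℝ) (hτ : 0 ≤ τ)
    (h0 : |s ⌊τ⌋₊ - L| ≤ ε) (h1 : |s (⌊τ⌋₊ + 1) - L| ≤ ε) : |interp s τ - L| ≤ ε := by
  rw [interp_eq_convex s τ hτ]
  have h2 : (⌊τ⌋₊ : ℝ) ≤ τ := Nat.floor_le hτ
  have h3 : τ < ⌊τ⌋₊ + 1 := Nat.lt_floor_add_one τ
  obtain ⟨u, hu⟩ : ∃ u, τ - (⌊τ⌋₊ : ℝ) = u := ⟨_, rfl⟩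
  have hu0 : 0 ≤ u := by linarith
  have hu1 : 0 ≤ 1 - u := by linarith
  rw [hu]
  rw [abs_le] at *
  constructor <;> nlinarith

lemma interp_continuousAt {M : Type*} [TopologicalSpace M] (G : ℕ → M → ℝ) (τ : M → ℝ) (x : M)
    (hG : ∀ n, ContinuousAt (G n) x) (hτ : ContinuousAt τ x) :
    ContinuousAt (fun z => interp (fun n => G n z) (τ z)) x := by
  have hev : ∀ᶠ z in 𝓝 x, τ z < ⌊τ x⌋₊ + 1 := hτ.eventually_lt_const (Nat.lt_floor_add_one _)
  have : ContinuousAt (fun z => G 0 z + ∑ n ∈ Finset.range (⌊τ x⌋₊ + 2),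
      max 0 (min 1 (τ z - n)) * (G (n + 1) z - G n z)) x := by
    refine (hG 0).add (tendsto_finsetSum _ fun n _ => ?_)
    exact (continuousAt_const.max (continuousAt_const.min (hτ.sub continuousAt_const))).mul
      ((hG (n + 1)).sub (hG n))
  refine this.congr ?_
  filter_upwards [hev] with z hz
  symm
  apply interp_eq_sum
  have : ⌊τ z⌋₊ < ⌊τ x⌋₊ + 1 := by
    apply (Nat.floor_lt' (by omega)).2
    exact_mod_cast hz
  omega

lemma interp_tendsto (s : ℕ → ℝ) (L : ℝ) (hs : Tendsto s atTop (𝓝 L)) :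
    Tendsto (interp s) atTop (𝓝 L) := by
  rw [Metric.tendsto_atTop] at hs
  rw [Metric.tendsto_atTop]
  intro ε hε
  obtain ⟨N, hN⟩ := hs (ε / 2) (by positivity)
  refine ⟨N, fun τ hτ => ?_⟩
  have hf : N ≤ ⌊τ⌋₊ := Nat.le_floor hτ
  have := interp_sub_le s τ L (ε / 2) (le_trans (Nat.cast_nonneg _) hτ)
    (hN _ hf).le (hN _ (by omega)).le
  rw [Real.dist_eq]
  linarith

lemma interp_sub_interp (s t : ℕ → ℝ) (τ ε : ℝ) (hτ : 0 ≤ τ)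
    (h : ∀ n : ℕ, (n : ℝ) ≤ τ + 1 → |s n - t n| ≤ ε) : |interp s τ - interp t τ| ≤ ε := by
  have h2 : (⌊τ⌋₊ : ℝ) ≤ τ := Nat.floor_le hτ
  have := interp_sub_le (fun n => s n - t n) τ 0 ε hτ (by simpa using h _ (by linarith))
    (by simpa using h (⌊τ⌋₊ + 1) (by push_cast; linarith))
  rw [interp_eq_convex _ _ hτ] at this
  rw [interp_eq_convex _ _ hτ, interp_eq_convex _ _ hτ]
  convert this using 2
  ring

noncomputable def tauf (r : ℝ) : ℝ := max 0 (-Real.logb 2 r - 2)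

lemma tauf_continuousAt (r : ℝ) (hr : r ≠ 0) : ContinuousAt tauf r := by
  unfold tauf
  have : ContinuousAt (Real.logb 2) r := Real.continuousAt_logb hr
  fun_prop

lemma tauf_tendsto : Tendsto tauf (𝓝[>] 0) atTop := by
  unfold tauf
  apply tendsto_atTop_mono (fun r => le_max_right _ _)
  have h : Tendsto (Real.logb 2) (𝓝[>] 0) atBot := Real.tendsto_logb_nhdsGT_zero (by norm_num)
  exact tendsto_atTop_add_const_right _ _ (tendsto_neg_atBot_atTop.comp h)

lemma tauf_bound (r : ℝ) (hr : 0 < r) (hr' : r < 1 / 4) (n : ℕ) (hn : (n : ℝ) ≤ tauf r + 1) :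
    r < (1 / 2) ^ n := by
  unfold tauf at hn
  have h4 : Real.logb 2 r ≤ -2 := by
    rw [Real.logb_le_iff_le_rpow (by norm_num) hr]
    norm_num [Real.rpow_neg]; linarith
  rw [max_eq_right (by linarith)] at hn
  have : Real.logb 2 r < -(n : ℝ) := by linarith
  rw [Real.logb_lt_iff_lt_rpow (by norm_num) hr] at this
  rw [Real.rpow_neg (by norm_num), Real.rpow_natCast] at this
  simpa using this

lemma core_s13 {M : Type*} [MetricSpace M] (C : Set M) (hC : IsClosed C) (hne : C.Nonempty)
    (G : ℕ → M → ℝ) (hG : ∀ n, Continuous (G n))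
    (hd : ∀ n a b, dist a b < (1 / 2) ^ n → |G n a - G n b| ≤ dist a b)
    (L : M → ℝ) (hL : ∀ c ∈ C, Tendsto (fun n => G n c) atTop (𝓝 (L c))) :
    ∃ F : M → M → ℝ, (∀ s, Continuous fun t => F s t) ∧ (∀ t, Continuous fun s => F s t) ∧
      ∀ c ∈ C, F c c = L c := by
  classical
  let r : M → M → ℝ := fun s t => dist s t + Metric.infDist s C
  have hr0 : ∀ s t, 0 ≤ r s t := fun s t => add_nonneg dist_nonneg Metric.infDist_nonneg
  have hrz : ∀ s t, r s t = 0 → s = t ∧ s ∈ C := by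
    intro s t h
    have h1 : 0 ≤ dist s t := dist_nonneg
    have h2 : 0 ≤ Metric.infDist s C := Metric.infDist_nonneg
    simp only [r] at h
    exact ⟨dist_eq_zero.1 (by linarith), (hC.mem_iff_infDist_zero hne).2 (by linarith)⟩
  have hrc : ∀ c ∈ C, r c c = 0 := by
    intro c hc
    simp [r, Metric.infDist_zero_of_mem hc]
  have hrs : ∀ s, Continuous (fun t => r s t) := fun s => by fun_prop
  have hrt : ∀ t, Continuous (fun s => r s t) := fun t => by
    have := Metric.continuous_infDist_pt C
    fun_prop
  let F : M → M → ℝ := fun s t =>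
    if r s t = 0 then L s else interp (fun n => G n s) (tauf (r s t))
  refine ⟨F, fun s => ?_, fun t => ?_, fun c hc => by simp [F, hrc c hc]⟩
  · rw [continuous_iff_continuousAt]
    intro t
    by_cases h : r s t = 0
    · obtain ⟨rfl, hs⟩ := hrz s t h
      have key : Tendsto (interp (fun n => G n s)) atTop (𝓝 (L s)) := interp_tendsto _ _ (hL s hs)
      have h2 := key.comp tauf_tendsto
      show Tendsto (fun t => F s t) (𝓝 s) (𝓝 (F s s))
      have hF : F s s = L s := by simp [F, h]
      rw [hF]
      rw [Metric.tendsto_nhds]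
      intro ε hε
      have h3 := (Metric.tendsto_nhds.1 h2 ε hε)
      rw [eventually_nhdsWithin_iff] at h3
      have h4 : Tendsto (fun t => r s t) (𝓝 s) (𝓝 0) := by
        have := (hrs s).tendsto s
        rwa [h] at this
      filter_upwards [h4.eventually h3] with t ht
      by_cases h5 : r s t = 0
      · simp [F, h5, hε]
      · simpa [F, h5] using ht (lt_of_le_of_ne (hr0 s t) (Ne.symm h5))
    · have h1 : ContinuousAt (fun t => interp (fun n => G n s) (tauf (r s t))) t := by
        apply interp_continuousAt (fun n _ => G n s)
        · intro n; exact continuousAt_const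
        · exact ContinuousAt.comp (f := fun t => r s t) (tauf_continuousAt _ h) (hrs s).continuousAt
      refine h1.congr ?_
      filter_upwards [(hrs s).continuousAt.eventually_ne h] with u hu
      simp [F, hu]
  · rw [continuous_iff_continuousAt]
    intro s
    by_cases h : r s t = 0
    · obtain ⟨rfl, hs⟩ := hrz s t h
      have key : Tendsto (interp (fun n => G n s)) atTop (𝓝 (L s)) := interp_tendsto _ _ (hL s hs)
      have h2 := key.comp tauf_tendsto
      show Tendsto (fun t => F t s) (𝓝 s) (𝓝 (F s s))
      have hF : F s s = L s := by simp [F, h]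
      rw [hF]
      rw [Metric.tendsto_nhds]
      intro ε hε
      have h3 := (Metric.tendsto_nhds.1 h2 (ε / 2) (by positivity))
      rw [eventually_nhdsWithin_iff] at h3
      have h4 : Tendsto (fun t => r t s) (𝓝 s) (𝓝 0) := by
        have := (hrt s).tendsto s
        rwa [h] at this
      filter_upwards [h4.eventually h3, h4.eventually_lt_const (show (0 : ℝ) < 1 / 4 by norm_num),
        h4.eventually_lt_const (show (0 : ℝ) < ε / 2 by positivity)] with t ht ht1 ht2
      by_cases h5 : r t s = 0
      · obtain ⟨rfl, -⟩ := hrz t s h5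
        simp [F, h5, hε]
      · have hpos := lt_of_le_of_ne (hr0 t s) (Ne.symm h5)
        have h6 := ht hpos
        have h7 : |interp (fun n => G n t) (tauf (r t s)) - interp (fun n => G n s) (tauf (r t s))|
            ≤ r t s := by
          apply interp_sub_interp
          · exact le_max_left _ _
          · intro n hn
            have hdr : dist t s ≤ r t s := le_add_of_nonneg_right Metric.infDist_nonneg
            exact (hd n t s (hdr.trans_lt (tauf_bound _ hpos ht1 n hn))).trans hdr
        simp only [F, h5, if_false]
        simp only [Function.comp, Real.dist_eq] at h6 ⊢
        have := abs_sub_le (interp (fun n => G n t) (tauf (r t s)))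
          (interp (fun n => G n s) (tauf (r t s))) (L s)
        linarith
    · have h1 : ContinuousAt (fun s => interp (fun n => G n s) (tauf (r s t))) s := by
        apply interp_continuousAt G
        · intro n; exact (hG n).continuousAt
        · exact ContinuousAt.comp (f := fun s => r s t) (tauf_continuousAt _ h) (hrt t).continuousAt
      refine h1.congr ?_
      filter_upwards [(hrt t).continuousAt.eventually_ne h] with u hu
      simp [F, hu]

lemma core_seq (C : Set (ℕ → ℝ)) (hC : IsClosed C) (hne : C.Nonempty)
    (hconv : ∀ c ∈ C, ∃ l, Tendsto c atTop (𝓝 l)) :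
    ∃ F : (ℕ → ℝ) → (ℕ → ℝ) → ℝ,
      (∀ s, Continuous fun t => F s t) ∧ (∀ t, Continuous fun s => F s t) ∧
      ∀ c ∈ C, Tendsto c atTop (𝓝 (F c c)) := by
  classical
  letI : MetricSpace (ℕ → ℝ) := PiCountable.metricSpace
  choose! L hL using hconv
  obtain ⟨F, h1, h2, h3⟩ := core_s13 C hC hne (fun n s => s n) (fun n => continuous_apply n)
    (by
      intro n a b h
      have := PiCountable.dist_le_dist_pi_of_dist_lt (x := a) (y := b) (i := n)
        (by simpa using h)
      simpa [Real.dist_eq] using this) L hL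
  exact ⟨F, h1, h2, fun c hc => by rw [h3 c hc]; exact hL c hc⟩

lemma compact_case {X Y : Type*} [TopologicalSpace X] [TopologicalSpace Y]
    [T2Space X] [T2Space Y] [NormalSpace X] [NormalSpace Y]
    (E : Set (X × Y)) (hE : IsCompact E) (hne : E.Nonempty)
    (hv : ∀ x : X, {y : Y | (x, y) ∈ E}.Subsingleton)
    (hh : ∀ y : Y, {x : X | (x, y) ∈ E}.Subsingleton)
    (g : E → ℝ) (gs : ℕ → E → ℝ) (hgs : ∀ n, Continuous (gs n))
    (hg : ∀ p : E, Tendsto (fun n => gs n p) atTop (𝓝 (g p))) :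
    ∃ f : X × Y → ℝ,
      (∀ x : X, Continuous fun y => f (x, y)) ∧
      (∀ y : Y, Continuous fun x => f (x, y)) ∧
      (∀ p : E, f p = g p) := by
  haveI : CompactSpace E := isCompact_iff_compactSpace.1 hE
  let h : C(E, ℕ → ℝ) := ⟨fun p n => gs n p, continuous_pi hgs⟩
  have e1 : IsClosedEmbedding (fun p : E => p.1.1) := by
    refine Continuous.isClosedEmbedding (by fun_prop) ?_
    rintro ⟨⟨x, y⟩, hp⟩ ⟨⟨x', y'⟩, hq⟩ hxx
    simp only at hxx
    subst hxx
    have := hv x hp hq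
    subst this
    rfl
  have e2 : IsClosedEmbedding (fun p : E => p.1.2) := by
    refine Continuous.isClosedEmbedding (by fun_prop) ?_
    rintro ⟨⟨x, y⟩, hp⟩ ⟨⟨x', y'⟩, hq⟩ hxx
    simp only at hxx
    subst hxx
    have := hh y hp hq
    subst this
    rfl
  obtain ⟨H, hH⟩ := ContinuousMap.exists_extension' e1 h
  obtain ⟨J, hJ⟩ := ContinuousMap.exists_extension' e2 h
  obtain ⟨F, h1, h2, h3⟩ := core_seq (range h) (isCompact_range h.continuous).isClosed
    (by obtain ⟨p, hp⟩ := hne; exact ⟨_, ⟨p, hp⟩, rfl⟩)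
    (by rintro _ ⟨p, rfl⟩; exact ⟨g p, hg p⟩)
  refine ⟨fun q => F (H q.1) (J q.2), fun x => (h1 (H x)).comp J.continuous,
    fun y => (h2 (J y)).comp H.continuous, fun p => ?_⟩
  have a1 : H p.1.1 = h p := congrFun hH p
  have a2 : J p.1.2 = h p := congrFun hJ p
  simp only [a1, a2]
  exact tendsto_nhds_unique (h3 (h p) ⟨p, rfl⟩) (hg p)


theorem stmt13 {X Y : Type*} [TopologicalSpace X] [TopologicalSpace Y]
    [LocallyCompactSpace X] [T2Space X] [LocallyCompactSpace Y] [T2Space Y] [ParacompactSpace (X × Y)]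
    (E : Set (X × Y)) (hEclosed : IsClosed E)
    (hv : ∀ x : X, {y : Y | (x, y) ∈ E}.Subsingleton)
    (hh : ∀ y : Y, {x : X | (x, y) ∈ E}.Subsingleton)
    (g : E → ℝ)
    (hg : ∃ gs : ℕ → E → ℝ, (∀ n, Continuous (gs n)) ∧
      ∀ p : E, Tendsto (fun n => gs n p) atTop (𝓝 (g p))) :
    ∃ f : X × Y → ℝ,
      (∀ x : X, Continuous fun y => f (x, y)) ∧
      (∀ y : Y, Continuous fun x => f (x, y)) ∧
      (∀ p : E, f p = g p) := by
  classical
  obtain ⟨gs, hgs, hlim⟩ := hg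
  have hloc : ∀ p : X × Y, ∃ W : Set (X × Y), ∃ f : X × Y → ℝ, IsOpen W ∧ p ∈ W ∧
      (∀ x : X, Continuous fun y => f (x, y)) ∧ (∀ y : Y, Continuous fun x => f (x, y)) ∧
      ∀ q : E, (q : X × Y) ∈ W → f q = g q := by
    intro p
    by_cases hp : p ∈ E
    · haveI : ParacompactSpace X := by
        have : IsClosedEmbedding (fun x : X => (x, p.2)) := by
          refine ⟨isEmbedding_prodMkLeft p.2, ?_⟩
          have : range (fun x : X => (x, p.2)) = Prod.snd ⁻¹' {p.2} := by
            ext ⟨a, b⟩; simp [eq_comm]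
          rw [this]
          exact isClosed_singleton.preimage continuous_snd
        exact this.paracompactSpace
      haveI : ParacompactSpace Y := by
        have : IsClosedEmbedding (fun y : Y => (p.1, y)) := by
          refine ⟨isEmbedding_prodMkRight p.1, ?_⟩
          have : range (fun y : Y => (p.1, y)) = Prod.fst ⁻¹' {p.1} := by
            ext ⟨a, b⟩; simp [eq_comm]
          rw [this]
          exact isClosed_singleton.preimage continuous_fst
        exact this.paracompactSpace
      obtain ⟨K, hK, hpK⟩ := exists_compact_mem_nhds p
      let E' : Set (X × Y) := K ∩ E
      have hE' : IsCompact E' := hK.inter_right hEclosed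
      let ι : E' → E := fun q => ⟨q.1, q.2.2⟩
      have hι : Continuous ι := by fun_prop
      obtain ⟨f, h1, h2, h3⟩ := compact_case E' hE' ⟨p, mem_of_mem_nhds hpK, hp⟩
        (fun x a ha b hb => hv x ha.2 hb.2) (fun y a ha b hb => hh y ha.2 hb.2)
        (g ∘ ι) (fun n => gs n ∘ ι) (fun n => (hgs n).comp hι) (fun q => hlim (ι q))
      refine ⟨interior K, f, isOpen_interior, mem_interior_iff_mem_nhds.2 hpK, h1, h2, ?_⟩
      intro q hq
      exact h3 ⟨q.1, interior_subset hq, q.2⟩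
    · refine ⟨Eᶜ, fun _ => 0, hEclosed.isOpen_compl, hp, fun _ => continuous_const,
        fun _ => continuous_const, fun q hq => absurd q.2 hq⟩
  choose W f hW hpW h1 h2 h3 using hloc
  obtain ⟨ρ, hρ⟩ := PartitionOfUnity.exists_isSubordinate (isClosed_univ (X := X × Y)) W hW
    (fun p _ => mem_iUnion.2 ⟨p, hpW p⟩)
  refine ⟨fun q => ∑ᶠ i, ρ i q * f i q, fun x => ?_, fun y => ?_, fun q => ?_⟩
  · have hc : Continuous (fun y : Y => (x, y)) := by fun_prop
    refine continuous_finsum (fun i => ((ρ i).continuous.comp hc).mul (h1 i x)) ?_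
    refine (ρ.locallyFinite.preimage_continuous hc).subset fun i y hy => ?_
    exact left_ne_zero_of_mul hy
  · have hc : Continuous (fun x : X => (x, y)) := by fun_prop
    refine continuous_finsum (fun i => ((ρ i).continuous.comp hc).mul (h2 i y)) ?_
    refine (ρ.locallyFinite.preimage_continuous hc).subset fun i x hx => ?_
    exact left_ne_zero_of_mul hx
  · have : ∀ i, ρ i q * f i q = ρ i q * g q := by
      intro i
      by_cases hi : (q : X × Y) ∈ W i
      · rw [h3 i q hi]
      · have : ρ i q = 0 := by
          by_contra hne
          exact hi (hρ i (subset_tsupport _ hne))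
        simp [this]
    simp only [this]
    rw [← finsum_mul', ρ.sum_eq_one (mem_univ _), one_mul]
    exact ρ.locallyFinite.point_finite _
end
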